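/- arXiv:1411.0321 — 3 statements merged into one kernel-verified Lean document; each statement's English description precedes it below -/
import Mathlib

section
/- Let x, z ∈ ℝ, y < 0, and let r : [0,1] → ℂ be continuous. If R : [0,1) → ℂ is differentiable, bounded on [0,1), and satisfies (1-τ)³ R'(τ) + [σ(τ,x,y,z) - (1-τ)²] R(τ) = r(τ) for all τ ∈ [0,1), then for every τ ∈ [0,1): R(τ) = (e^{Λ(τ,x,y,z)}/(τ-1)) · ∫_τ¹ r(θ) e^{-Λ(θ,x,y,z)}/(θ-1)² dθ. -/
open MeasureTheory Set

noncomputable def wSigma (τ x y z : ℝ) : ℂ :=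
  Complex.I * (x : ℂ) * ((τ * (1 - τ) / Real.sqrt (2 * τ ^ 2 - 2 * τ + 1) : ℝ) : ℂ)
    + 2 * (y : ℂ) * (τ : ℂ)
    + Complex.I * (z : ℂ) * (((3 * τ ^ 2 - 2 * τ + 1) / Real.sqrt (2 * τ ^ 2 - 2 * τ + 1) : ℝ) : ℂ)

noncomputable def wLam (τ x y z : ℝ) : ℂ :=
  -(((τ : ℂ) - 1) ^ 2)⁻¹ * ((y : ℂ) + Complex.I * (z : ℂ) * ((τ * Real.sqrt (2 * τ ^ 2 - 2 * τ + 1) : ℝ) : ℂ))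
    - ((τ : ℂ) - 1)⁻¹ * (2 * (y : ℂ) - Complex.I * (x : ℂ) * ((Real.sqrt (2 * τ ^ 2 - 2 * τ + 1) : ℝ) : ℂ))

/-- The exponent `Λ` is a primitive of `-σ / (1 - τ)³`. -/
theorem hasDerivAt_wLam (x y z : ℝ) {τ : ℝ} (hτ : τ < 1) :
    HasDerivAt (fun t : ℝ => wLam t x y z) (-wSigma τ x y z / (1 - (τ : ℂ)) ^ 3) τ := by
  have hpos : 0 < 2 * τ ^ 2 - 2 * τ + 1 := by nlinarith [sq_nonneg (2 * τ - 1)]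
  set s := Real.sqrt (2 * τ ^ 2 - 2 * τ + 1) with hs
  have hs0 : 0 < s := Real.sqrt_pos.mpr hpos
  have hsq : (s : ℂ) ^ 2 = 2 * (τ : ℂ) ^ 2 - 2 * τ + 1 := by
    exact_mod_cast Real.sq_sqrt hpos.le
  have hquad : HasDerivAt (fun t : ℝ => 2 * t ^ 2 - 2 * t + 1) (4 * τ - 2) τ := by
    refine HasDerivAt.congr_deriv ((((hasDerivAt_id τ).pow 2).const_mul 2).sub
      ((hasDerivAt_id τ).const_mul 2) |>.add_const 1) ?_
    simp only [id]
    ring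
  have hroot : HasDerivAt (fun t : ℝ => Real.sqrt (2 * t ^ 2 - 2 * t + 1))
      ((4 * τ - 2) / (2 * s)) τ := hquad.sqrt hpos.ne'
  have hroot' := hroot.ofReal_comp
  have hmul := ((hasDerivAt_id τ).mul hroot).ofReal_comp
  have hlin : HasDerivAt (fun t : ℝ => (t : ℂ) - 1) 1 τ := by
    simpa using (hasDerivAt_id τ).ofReal_comp.sub_const (1 : ℂ)
  have hne : (τ : ℂ) - 1 ≠ 0 := sub_ne_zero.mpr (by exact_mod_cast hτ.ne)
  have hne' : 1 - (τ : ℂ) ≠ 0 := sub_ne_zero.mpr (by exact_mod_cast hτ.ne')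
  have hsne : (s : ℂ) ≠ 0 := by exact_mod_cast hs0.ne'
  have h := ((((hlin.pow 2).inv (pow_ne_zero 2 hne)).neg).mul
    ((hmul.const_mul (Complex.I * (z : ℂ))).const_add (y : ℂ))).sub
    ((hlin.inv hne).mul
      ((hroot'.const_mul (Complex.I * (x : ℂ))).const_sub (2 * (y : ℂ))))
  refine HasDerivAt.congr_deriv h ?_
  simp only [wSigma, ← hs, Pi.pow_apply, Pi.inv_apply, Pi.neg_apply, Pi.mul_apply, id]
  push_cast
  generalize (s : ℂ) = S at *
  generalize (τ : ℂ) = T at *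
  have hu : T = 1 - (1 - T) := by ring
  generalize 1 - T = u at *
  subst hu
  simp only [show 1 - u - 1 = -u by ring]
  field_simp
  linear_combination
    (-4 * Complex.I * z * (1 - u) - 2 * u * Complex.I * z - 2 * u * Complex.I * x) * hsq

theorem norm_exp_neg_wLam (x y z τ : ℝ) :
    ‖Complex.exp (-wLam τ x y z)‖ = Real.exp (y * ((1 - τ)⁻¹ - 1) ^ 2) * Real.exp (-y) := by
  rw [Complex.norm_exp, ← Real.exp_add]
  congr 1
  have hinv : (1 - τ)⁻¹ = -(τ - 1)⁻¹ := by rw [← inv_neg, neg_sub]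
  have h : -wLam τ x y z = ((y * ((1 - τ)⁻¹ - 1) ^ 2 + -y : ℝ) : ℂ)
      + ((z * ((τ - 1) ^ 2)⁻¹ * (τ * Real.sqrt (2 * τ ^ 2 - 2 * τ + 1))
        - x * (τ - 1)⁻¹ * Real.sqrt (2 * τ ^ 2 - 2 * τ + 1) : ℝ) : ℂ) * Complex.I := by
    rw [wLam, hinv]
    push_cast
    simp only [← inv_pow]
    ring
  rw [h, Complex.add_re, Complex.ofReal_re, Complex.re_ofReal_mul, Complex.I_re, mul_zero, add_zero]

theorem norm_exp_neg_wLam_le (x z τ : ℝ) {y : ℝ} (hy : y < 0) :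
    ‖Complex.exp (-wLam τ x y z)‖ ≤ Real.exp (-y) := by
  rw [norm_exp_neg_wLam x y z τ]
  refine mul_le_of_le_one_left (Real.exp_pos _).le (Real.exp_le_one_iff.mpr ?_)
  exact mul_nonpos_of_nonpos_of_nonneg hy.le (sq_nonneg _)

theorem norm_exp_neg_wLam_div_sq_le (x z : ℝ) {y τ : ℝ} (hy : y < 0) (hτ : τ < 1) :
    ‖Complex.exp (-wLam τ x y z) / ((τ : ℂ) - 1) ^ 2‖ ≤ (2 / (-y) + 2) * Real.exp (-y) := by
  have hnorm : ‖(τ : ℂ) - 1‖ = 1 - τ := by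
    rw [← Complex.ofReal_one, ← Complex.ofReal_sub, Complex.norm_real, Real.norm_eq_abs,
      abs_of_neg (sub_neg.mpr hτ), neg_sub]
  rw [norm_div, norm_pow, hnorm, norm_exp_neg_wLam x y z τ, div_eq_mul_inv, ← inv_pow,
    mul_right_comm]
  refine mul_le_mul_of_nonneg_right ?_ (Real.exp_pos _).le
  set w := (1 - τ)⁻¹
  set E := Real.exp (y * (w - 1) ^ 2) with hE
  have hE0 : 0 < E := Real.exp_pos _
  have hE1 : E * (1 - y * (w - 1) ^ 2) ≤ 1 := by
    have h1 := Real.add_one_le_exp (-(y * (w - 1) ^ 2))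
    have h2 : E * Real.exp (-(y * (w - 1) ^ 2)) = 1 := by
      rw [hE, ← Real.exp_add, add_neg_cancel, Real.exp_zero]
    calc E * (1 - y * (w - 1) ^ 2) ≤ E * Real.exp (-(y * (w - 1) ^ 2)) :=
          mul_le_mul_of_nonneg_left (by linarith) hE0.le
      _ = 1 := h2
  have ht : 0 ≤ E * (w - 1) ^ 2 := by positivity
  have hE2 : E ≤ 1 := by nlinarith
  have ht2 : E * (w - 1) ^ 2 ≤ 1 / (-y) := by
    rw [le_div_iff₀ (neg_pos.mpr hy)]
    nlinarith
  have hw : E * w ^ 2 ≤ 2 * (E * (w - 1) ^ 2) + 2 * E := by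
    nlinarith [mul_nonneg hE0.le (sq_nonneg (w - 2))]
  calc E * w ^ 2 ≤ 2 * (1 / (-y)) + 2 := by linarith
    _ = 2 / (-y) + 2 := by ring

theorem intervalIntegrable_levin_integrand (x z : ℝ) {y : ℝ} (hy : y < 0) {r : ℝ → ℂ}
    (hr : ContinuousOn r (Set.Icc 0 1)) {τ : ℝ} (hτ : τ ∈ Set.Ico (0 : ℝ) 1) :
    IntervalIntegrable (fun θ : ℝ => r θ * Complex.exp (-(wLam θ x y z)) / ((θ : ℂ) - 1) ^ 2)
      volume τ 1 := by
  obtain ⟨M, hM⟩ := isCompact_Icc.exists_bound_of_continuousOn hr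
  rw [intervalIntegrable_iff_integrableOn_Ioo_of_le hτ.2.le]
  refine IntegrableOn.of_bound measure_Ioo_lt_top ?_ (M * ((2 / (-y) + 2) * Real.exp (-y))) ?_
  · refine ContinuousOn.aestronglyMeasurable ?_ measurableSet_Ioo
    refine ContinuousOn.div (ContinuousOn.mul ?_ ?_) (by fun_prop) ?_
    · exact hr.mono fun θ hθ => ⟨hτ.1.trans hθ.1.le, hθ.2.le⟩
    · exact fun θ hθ => (hasDerivAt_wLam x y z hθ.2).continuousAt.neg.cexp.continuousWithinAt
    · exact fun θ hθ => pow_ne_zero 2 (sub_ne_zero.mpr (by exact_mod_cast hθ.2.ne))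
  · refine (ae_restrict_iff' measurableSet_Ioo).mpr (.of_forall fun θ hθ => ?_)
    have hMθ := hM θ ⟨hτ.1.trans hθ.1.le, hθ.2.le⟩
    rw [mul_div_assoc, norm_mul]
    exact mul_le_mul hMθ (norm_exp_neg_wLam_div_sq_le x z hy hθ.2) (norm_nonneg _)
      ((norm_nonneg _).trans hMθ)

/-- Representation of the bounded solution of the inhomogeneous Levin ODE with right-hand
side `r`: any differentiable, bounded solution `R` on `[0,1)` is given by
`R(τ) = (e^{Λ(τ)}/(τ-1)) ∫_τ¹ r(θ) e^{-Λ(θ)}/(θ-1)² dθ`. -/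
theorem levin_ODE_residual_representation (x y z : ℝ) (hy : y < 0)
    (r : ℝ → ℂ) (hr : ContinuousOn r (Set.Icc 0 1))
    (R R' : ℝ → ℂ)
    (hd : ∀ τ ∈ Set.Ico (0 : ℝ) 1, HasDerivWithinAt R (R' τ) (Set.Ico (0 : ℝ) 1) τ)
    (hb : ∃ C : ℝ, ∀ τ ∈ Set.Ico (0 : ℝ) 1, ‖R τ‖ ≤ C)
    (hODE : ∀ τ ∈ Set.Ico (0 : ℝ) 1,
      (1 - (τ : ℂ)) ^ 3 * R' τ + (wSigma τ x y z - (1 - (τ : ℂ)) ^ 2) * R τ = r τ) :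
    ∀ τ ∈ Set.Ico (0 : ℝ) 1,
      R τ = Complex.exp (wLam τ x y z) / ((τ : ℂ) - 1) *
        ∫ θ in τ..1, r θ * Complex.exp (-(wLam θ x y z)) / ((θ : ℂ) - 1) ^ 2 := by
  intro τ hτ
  obtain ⟨C, hC⟩ := hb
  set G : ℝ → ℂ := fun t => R t * (((t : ℂ) - 1) * Complex.exp (-wLam t x y z)) with hG
  have hlin (t : ℝ) : HasDerivAt (fun t : ℝ => (t : ℂ) - 1) 1 t := by
    simpa using (hasDerivAt_id t).ofReal_comp.sub_const (1 : ℂ)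
  have hne {t : ℝ} (ht : t < 1) : (t : ℂ) - 1 ≠ 0 := sub_ne_zero.mpr (by exact_mod_cast ht.ne)
  have hderiv : ∀ t ∈ Set.Ico (0 : ℝ) 1, HasDerivWithinAt G
      (-(r t * Complex.exp (-(wLam t x y z)) / ((t : ℂ) - 1) ^ 2)) (Set.Ico (0 : ℝ) 1) t := by
    intro t ht
    have h := (hd t ht).mul
      ((hlin t).mul (hasDerivAt_wLam x y z ht.2).neg.cexp).hasDerivWithinAt
    refine h.congr_deriv ?_
    rw [← hODE t ht]
    have h1 := hne ht.2
    have h2 : 1 - (t : ℂ) ≠ 0 := by rwa [← neg_sub, neg_ne_zero]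
    have h3 : (t : ℂ) - 1 = -(1 - t) := by ring
    simp only [Pi.mul_apply, Pi.neg_apply, h3]
    field_simp
    ring
  have hleft : Filter.Tendsto G (nhdsWithin τ (Set.Ioi τ)) (nhds (G τ)) := by
    have h := (hderiv τ hτ).continuousWithinAt.mono (Set.Ico_subset_Ico_left hτ.1)
    exact (h.mono_of_mem_nhdsWithin (Ico_mem_nhdsGE hτ.2)).mono Set.Ioi_subset_Ici_self
  have hright : Filter.Tendsto G (nhdsWithin 1 (Set.Iio 1)) (nhds 0) := by
    have hlim : Filter.Tendsto (fun t : ℝ => C * ((1 - t) * Real.exp (-y)))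
        (nhdsWithin 1 (Set.Iio 1)) (nhds 0) := by
      have : Continuous fun t : ℝ => C * ((1 - t) * Real.exp (-y)) := by fun_prop
      simpa using (this.tendsto 1).mono_left nhdsWithin_le_nhds
    refine squeeze_zero_norm' ?_ hlim
    filter_upwards [Ico_mem_nhdsLT (zero_lt_one' ℝ)] with t ht
    have hnorm : ‖(t : ℂ) - 1‖ = 1 - t := by
      rw [← Complex.ofReal_one, ← Complex.ofReal_sub, Complex.norm_real, Real.norm_eq_abs,
        abs_of_neg (sub_neg.mpr ht.2), neg_sub]
    rw [hG, norm_mul, norm_mul, hnorm]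
    have h0 : 0 ≤ 1 - t := sub_nonneg.mpr ht.2.le
    exact mul_le_mul (hC t ht)
      (mul_le_mul_of_nonneg_left (norm_exp_neg_wLam_le x z t hy) h0) (by positivity)
      ((norm_nonneg _).trans (hC t ht))
  have hint := intervalIntegral.integral_eq_sub_of_hasDerivAt_of_tendsto hτ.2
    (fun t ht => (hderiv t ⟨hτ.1.trans ht.1.le, ht.2⟩).hasDerivAt
      (Ico_mem_nhds (hτ.1.trans_lt ht.1) ht.2))
    (intervalIntegrable_levin_integrand x z hy hr hτ).neg hleft hright
  rw [intervalIntegral.integral_neg, zero_sub, neg_inj] at hint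
  rw [hint]
  simp only [hG, Complex.exp_neg]
  have h1 := hne hτ.2
  have h2 := Complex.exp_ne_zero (wLam τ x y z)
  field_simp
end

section
/- Let x ≤ 0, y < 0, z > 0, let θ ∈ (0, π/4] be the steepest-descent angle defined by cos 2θ = -y/√(y²+z²) and sin 2θ = z/√(y²+z²), and set t* = |x| sin θ / (2(|y| cos θ + z sin θ)). Then ∫₀^∞ e^{ϖ(t,x,y,z)} dt = ∫₀^{t*} e^{ϖ(t,x,y,z)} dt + e^{iθ} ∫₀^∞ e^{ϖ(t*+te^{iθ},x,y,z)} dt, where ϖ is extended to complex arguments by the principal branch of the square root (note Re(1 + (t*+te^{iθ})²) > 0 for all t ≥ 0), and the rotated integral converges absolutely. -/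
open MeasureTheory Set

noncomputable def wPhase (t x y z : ℝ) : ℂ :=
  (y * (1 + t ^ 2) : ℝ) + Complex.I * ((x + z * t : ℝ) : ℂ) * ((Real.sqrt (1 + t ^ 2) : ℝ) : ℂ)

/-- The phase extended to complex arguments via the principal branch of the square root. -/
noncomputable def wPhaseC (w : ℂ) (x y z : ℝ) : ℂ :=
  (y : ℂ) * (1 + w ^ 2) + Complex.I * ((x : ℂ) + (z : ℂ) * w) * (1 + w ^ 2) ^ ((1 : ℂ) / 2)

/-- On a convex set where a holomorphic `f` decays exponentially in the real part, the ray
integrals of `f` converge absolutely. -/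
lemma integrableOn_ray {f : ℂ → ℂ} {S : Set ℂ} (hf : ContinuousOn f S) {M : ℝ}
    (hM : ∀ w ∈ S, ‖f w‖ ≤ M * Real.exp (-w.re)) {a e : ℂ} (he : 0 < e.re)
    (hray : ∀ t : ℝ, 0 ≤ t → a + t * e ∈ S) :
    IntegrableOn (fun t : ℝ => f (a + t * e)) (Ioi 0) := by
  have hdom : IntegrableOn (fun t : ℝ => M * Real.exp (-a.re) * Real.exp (-e.re * t)) (Ioi 0) :=
    (exp_neg_integrableOn_Ioi 0 he).const_mul _
  refine hdom.mono' ?_ ?_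
  · refine ContinuousOn.aestronglyMeasurable ?_ measurableSet_Ioi
    exact hf.comp (by fun_prop) fun t ht => hray t (le_of_lt ht)
  · refine (ae_restrict_iff' measurableSet_Ioi).2 (.of_forall fun t ht => ?_)
    refine (hM _ (hray t (le_of_lt ht))).trans_eq ?_
    rw [mul_assoc, ← Real.exp_add]
    congr 2
    simp
    ring

/-- Fundamental theorem of calculus along a segment of a ray. -/
lemma mul_integral_ray_eq_sub {f F : ℂ → ℂ} {S : Set ℂ} (hf : ContinuousOn f S)
    (hF : ∀ w ∈ S, HasDerivWithinAt F (f w) S w) {a e : ℂ}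
    (hray : ∀ t : ℝ, 0 ≤ t → a + t * e ∈ S) {R : ℝ} (hR : 0 ≤ R) :
    e * ∫ t in (0 : ℝ)..R, f (a + t * e) = F (a + R * e) - F a := by
  have hline (t : ℝ) : HasDerivAt (fun t : ℝ => a + t * e) e t := by
    simpa using (Complex.ofRealCLM.hasDerivAt (x := t)).mul_const e |>.const_add a
  rw [← intervalIntegral.integral_const_mul]
  have h := intervalIntegral.integral_eq_sub_of_hasDeriv_right_of_le
    (f := fun t : ℝ => F (a + t * e))
    (f' := fun t : ℝ => e * f (a + t * e)) hR ?_ ?_ ?_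
  · simpa using h
  · have hFc : ContinuousOn F S := fun w hw => (hF w hw).continuousWithinAt
    exact hFc.comp (by fun_prop) fun t ht => hray t ht.1
  · intro t ht
    exact (hF _ (hray t ht.1.le)).scomp t (hline t).hasDerivWithinAt
      fun s hs => hray s (ht.1.le.trans (le_of_lt hs))
  · refine ContinuousOn.intervalIntegrable_of_Icc hR (continuousOn_const.mul ?_)
    exact hf.comp (by fun_prop) fun t ht => hray t ht.1

/-- Rotation of a ray of integration inside a convex set on which a holomorphic function decays
exponentially in the real part. -/
lemma mul_integral_ray_eq {f : ℂ → ℂ} {S : Set ℂ} (hS : Convex ℝ S)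
    (hf : DifferentiableOn ℂ f S) {M : ℝ}
    (hM : ∀ w ∈ S, ‖f w‖ ≤ M * Real.exp (-w.re)) {a e₁ e₂ : ℂ}
    (he₁ : 0 < e₁.re) (he₂ : 0 < e₂.re) (hray₁ : ∀ t : ℝ, 0 ≤ t → a + t * e₁ ∈ S)
    (hray₂ : ∀ t : ℝ, 0 ≤ t → a + t * e₂ ∈ S) :
    e₁ * ∫ t in Ioi (0 : ℝ), f (a + t * e₁) = e₂ * ∫ t in Ioi (0 : ℝ), f (a + t * e₂) := by
  obtain ⟨F, hF⟩ := hS.exists_forall_hasDerivWithinAt hf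
  have hfc := hf.continuousOn
  have hM0 : 0 ≤ M := by
    have h := (norm_nonneg _).trans (hM _ (hray₁ 0 le_rfl))
    exact nonneg_of_mul_nonneg_left h (Real.exp_pos _)
  have hlim {e : ℂ} (he : 0 < e.re) (hray : ∀ t : ℝ, 0 ≤ t → a + t * e ∈ S) :=
    (intervalIntegral_tendsto_integral_Ioi 0 (integrableOn_ray hfc hM he hray)
      Filter.tendsto_id).const_mul e
  refine sub_eq_zero.1 (tendsto_nhds_unique ((hlim he₁ hray₁).sub (hlim he₂ hray₂)) ?_)
  set c := min e₁.re e₂.re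
  have hc : 0 < c := lt_min he₁ he₂
  have hdecay : Filter.Tendsto
      (fun R : ℝ => M * Real.exp (-a.re) * ‖e₁ - e₂‖ * (R ^ (1 : ℝ) * Real.exp (-c * R)))
      Filter.atTop (nhds 0) := by
    simpa using (tendsto_rpow_mul_exp_neg_mul_atTop_nhds_zero 1 c hc).const_mul
      (M * Real.exp (-a.re) * ‖e₁ - e₂‖)
  refine squeeze_zero_norm' ?_ hdecay
  filter_upwards [Filter.eventually_ge_atTop 0] with R hR
  simp only [id]
  rw [mul_integral_ray_eq_sub hfc hF hray₁ hR, mul_integral_ray_eq_sub hfc hF hray₂ hR,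
    sub_sub_sub_cancel_right]
  set T : Set ℂ := S ∩ {w | a.re + c * R ≤ w.re}
  have hT : Convex ℝ T := hS.inter (convex_halfSpace_re_ge _)
  have hmem {e : ℂ} (hce : c ≤ e.re) (hray : ∀ t : ℝ, 0 ≤ t → a + t * e ∈ S) : a + R * e ∈ T := by
    refine ⟨hray R hR, ?_⟩
    have := mul_le_mul_of_nonneg_right hce hR
    simp only [mem_ofPred_eq, Complex.add_re, Complex.re_ofReal_mul]
    linarith
  refine (Convex.norm_image_sub_le_of_norm_hasDerivWithin_le
    (C := M * Real.exp (-(a.re + c * R)))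
    (fun w hw => (hF w hw.1).mono inter_subset_left) (fun w hw => (hM w hw.1).trans ?_) hT
    (hmem (min_le_right _ _) hray₂) (hmem (min_le_left _ _) hray₁)).trans_eq ?_
  · have := hw.2
    simp only [mem_ofPred_eq] at this
    gcongr
  · rw [add_sub_add_left_eq_sub, ← mul_sub, norm_mul, Complex.norm_real, Real.norm_of_nonneg hR,
      neg_add, Real.exp_add, Real.rpow_one, neg_mul]
    ring

lemma wPhaseC_ofReal (t x y z : ℝ) : wPhaseC t x y z = wPhase t x y z := by
  have h : ((1 : ℂ) + (t : ℂ) ^ 2) ^ ((1 : ℂ) / 2) = (Real.sqrt (1 + t ^ 2) : ℝ) := by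
    rw [Real.sqrt_eq_rpow, Complex.ofReal_cpow (by positivity)]
    push_cast
    rfl
  rw [wPhaseC, wPhase, h]
  push_cast
  rfl

/-- The closed sector between the nonnegative real axis and the half-line of slope `k`. -/
def slopeSector (k : ℝ) : Set ℂ := {w | 0 ≤ w.re} ∩ ({w | 0 ≤ w.im} ∩ {w | w.im ≤ k * w.re})

lemma convex_slopeSector (k : ℝ) : Convex ℝ (slopeSector k) := by
  refine (convex_halfSpace_re_ge 0).inter ((convex_halfSpace_im_ge 0).inter ?_)
  intro u hu v hv α β hα hβ _
  simp only [mem_ofPred_eq, Complex.add_im, Complex.add_re, Complex.real_smul,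
    Complex.re_ofReal_mul, Complex.im_ofReal_mul] at hu hv ⊢
  linarith [mul_le_mul_of_nonneg_left hu hα, mul_le_mul_of_nonneg_left hv hβ]

lemma one_add_sq_re (w : ℂ) : (1 + w ^ 2).re = 1 + w.re ^ 2 - w.im ^ 2 := by
  simp [sq]
  ring

lemma im_sq_le_of_mem_slopeSector {k : ℝ} {w : ℂ} (hw : w ∈ slopeSector k) :
    w.im ^ 2 ≤ k ^ 2 * w.re ^ 2 := by
  rw [← mul_pow]
  exact pow_le_pow_left₀ hw.2.1 hw.2.2 2

lemma one_add_sq_re_pos {k : ℝ} (hk₀ : 0 ≤ k) (hk : k < 1) {w : ℂ} (hw : w ∈ slopeSector k) :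
    0 < (1 + w ^ 2).re := by
  rw [one_add_sq_re]
  nlinarith [im_sq_le_of_mem_slopeSector hw, sq_nonneg w.re,
    mul_nonneg (sq_nonneg w.re) (sub_nonneg.2 (pow_le_one₀ (n := 2) hk₀ hk.le))]

lemma differentiableOn_exp_wPhaseC {k : ℝ} (hk₀ : 0 ≤ k) (hk : k < 1) (x y z : ℝ) :
    DifferentiableOn ℂ (fun w => Complex.exp (wPhaseC w x y z)) (slopeSector k) := by
  intro w hw
  have hslit : 1 + w ^ 2 ∈ Complex.slitPlane := Or.inl (one_add_sq_re_pos hk₀ hk hw)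
  refine DifferentiableAt.differentiableWithinAt ?_
  unfold wPhaseC
  have : DifferentiableAt ℂ (fun w : ℂ => (1 + w ^ 2) ^ ((1 : ℂ) / 2)) w :=
    DifferentiableAt.cpow (by fun_prop) (by fun_prop) hslit
  fun_prop

lemma wPhaseC_re_le {x y z k : ℝ} (hx : x ≤ 0) (hy : y < 0) (hz : 0 < z)
    (hk : k < 1) {w : ℂ} (hw : w ∈ slopeSector k) :
    (wPhaseC w x y z).re ≤ y * (1 - k ^ 2) * w.re ^ 2 + |x| * (1 + 2 * w.re) := by
  have hu : 0 ≤ w.re := hw.1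
  have hv : 0 ≤ w.im := hw.2.1
  have hvk := im_sq_le_of_mem_slopeSector hw
  have hvu : w.im ≤ w.re := hw.2.2.trans (mul_le_of_le_one_left hu hk.le)
  set s := (1 + w ^ 2) ^ ((1 : ℂ) / 2) with hs
  have him : 0 ≤ (1 + w ^ 2).im := by
    simp only [sq, Complex.add_im, Complex.one_im, Complex.mul_im]
    positivity
  have hp : 0 ≤ s.re := by
    rw [hs, one_div, Complex.cpow_inv_two_re]
    positivity
  have hq : 0 ≤ s.im := by
    rw [hs, one_div, Complex.cpow_inv_two_im_eq_sqrt him]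
    positivity
  have hsq : s ^ 2 = 1 + w ^ 2 := by
    rw [hs, one_div]
    exact Complex.cpow_nat_inv_pow _ two_ne_zero
  have hnorm : ‖s‖ ^ 2 ≤ 1 + ‖w‖ ^ 2 := by
    rw [← norm_pow, hsq, ← norm_pow]
    exact (norm_add_le 1 (w ^ 2)).trans_eq (by rw [norm_one])
  rw [← Complex.normSq_eq_norm_sq, ← Complex.normSq_eq_norm_sq, Complex.normSq_apply,
    Complex.normSq_apply] at hnorm
  have hqu : s.im ≤ 1 + 2 * w.re := by
    refine (pow_le_pow_iff_left₀ hq (by positivity) two_ne_zero).1 ?_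
    nlinarith
  have hre : (wPhaseC w x y z).re =
      y * (1 + w.re ^ 2 - w.im ^ 2) - x * s.im - z * (w.re * s.im + w.im * s.re) := by
    rw [wPhaseC, ← hs, ← one_add_sq_re]
    simp [-Complex.one_re]
    ring
  rw [hre, abs_of_nonpos hx]
  have h1 : y * (1 + w.re ^ 2 - w.im ^ 2) ≤ y * ((1 - k ^ 2) * w.re ^ 2) :=
    mul_le_mul_of_nonpos_left (by linarith) hy.le
  have h2 : -x * s.im ≤ -x * (1 + 2 * w.re) := mul_le_mul_of_nonneg_left hqu (by linarith)
  have h3 : 0 ≤ z * (w.re * s.im + w.im * s.re) := by positivity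
  linarith

/-- In a sector of slope less than one, `exp (wPhaseC ·)` decays exponentially. -/
lemma exists_norm_exp_wPhaseC_le {x y z k : ℝ} (hx : x ≤ 0) (hy : y < 0) (hz : 0 < z)
    (hk₀ : 0 ≤ k) (hk : k < 1) :
    ∃ M, ∀ w ∈ slopeSector k, ‖Complex.exp (wPhaseC w x y z)‖ ≤ M * Real.exp (-w.re) := by
  have hk2 : 0 < 1 - k ^ 2 := sub_pos.2 (pow_lt_one₀ hk₀ hk two_ne_zero)
  set c := -y * (1 - k ^ 2) with hc
  have hc0 : 0 < c := mul_pos (neg_pos.2 hy) hk2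
  refine ⟨Real.exp (|x| + (2 * |x| + 1) ^ 2 / (4 * c)), fun w hw => ?_⟩
  rw [Complex.norm_exp, ← Real.exp_add, Real.exp_le_exp]
  refine (wPhaseC_re_le hx hy hz hk hw).trans ?_
  have hsq : (2 * |x| + 1) * w.re - c * w.re ^ 2 ≤ (2 * |x| + 1) ^ 2 / (4 * c) := by
    rw [le_div_iff₀ (by positivity)]
    nlinarith [sq_nonneg (2 * c * w.re - (2 * |x| + 1))]
  have : y * (1 - k ^ 2) = -c := by rw [hc]; ring
  rw [this]
  linarith

lemma setIntegral_Ioi_eq_comp_add (f : ℝ → ℂ) (a : ℝ) :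
    ∫ t in Ioi a, f t = ∫ t in Ioi (0 : ℝ), f (a + t) := by
  have h := (measurePreserving_add_left volume a).setIntegral_preimage_emb
    (measurableEmbedding_addLeft a) f (Ioi a)
  simpa using h.symm

/-- Split-and-rotate representation of the wavelike integral for `z > 0`: with the
steepest-descent angle `θ ∈ (0,π/4]` and splitting point
`t* = |x| sin θ/(2(|y|cos θ + z sin θ))`, one has `Re(1+(t*+te^{iθ})²) > 0` for `t ≥ 0`,
the rotated integral converges absolutely, and
`∫₀^∞ e^{ϖ(t)} dt = ∫₀^{t*} e^{ϖ(t)} dt + e^{iθ} ∫₀^∞ e^{ϖ(t*+te^{iθ})} dt`. -/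
theorem contour_split_and_rotate (x y z θ tstar : ℝ) (hx : x ≤ 0) (hy : y < 0) (hz : 0 < z)
    (hθ : θ ∈ Set.Ioc 0 (Real.pi / 4))
    (hcos : Real.cos (2 * θ) = -y / Real.sqrt (y ^ 2 + z ^ 2))
    (hsin : Real.sin (2 * θ) = z / Real.sqrt (y ^ 2 + z ^ 2))
    (htstar : tstar = |x| * Real.sin θ / (2 * (|y| * Real.cos θ + z * Real.sin θ))) :
    (∀ t : ℝ, 0 ≤ t →
      0 < (1 + ((tstar : ℂ) + (t : ℂ) * Complex.exp (Complex.I * (θ : ℂ))) ^ 2).re) ∧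
    IntegrableOn
      (fun t : ℝ => Complex.exp
        (wPhaseC ((tstar : ℂ) + (t : ℂ) * Complex.exp (Complex.I * (θ : ℂ))) x y z))
      (Set.Ioi 0) ∧
    ∫ t in Set.Ioi (0 : ℝ), Complex.exp (wPhase t x y z) =
      (∫ t in (0 : ℝ)..tstar, Complex.exp (wPhase t x y z)) +
        Complex.exp (Complex.I * (θ : ℂ)) *
          ∫ t in Set.Ioi (0 : ℝ),
            Complex.exp
              (wPhaseC ((tstar : ℂ) + (t : ℂ) * Complex.exp (Complex.I * (θ : ℂ))) x y z) := by
  obtain ⟨hθ0, hθ4⟩ := hθ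
  have hsin_pos : 0 < Real.sin θ :=
    Real.sin_pos_of_pos_of_lt_pi hθ0 (by linarith [Real.pi_pos])
  have hcos_pos : 0 < Real.cos θ :=
    Real.cos_pos_of_mem_Ioo ⟨by linarith [Real.pi_pos], by linarith [Real.pi_pos]⟩
  have ha : 0 ≤ tstar := by
    rw [htstar]
    positivity
  have hlt : Real.sin θ < Real.cos θ := by
    have h2 : 0 < Real.cos (2 * θ) := by
      rw [hcos]
      exact div_pos (neg_pos.2 hy) (Real.sqrt_pos.2 (by positivity))
    rw [Real.cos_two_mul'] at h2
    exact lt_of_pow_lt_pow_left₀ 2 hcos_pos.le (sub_pos.1 h2)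
  set k := Real.sin θ / Real.cos θ with hkdef
  have hk₀ : 0 ≤ k := by positivity
  have hk : k < 1 := (div_lt_one hcos_pos).2 hlt
  set e := Complex.exp (Complex.I * (θ : ℂ)) with he
  have here : e.re = Real.cos θ := by
    rw [he, mul_comm, Complex.exp_ofReal_mul_I_re]
  have heim : e.im = Real.sin θ := by
    rw [he, mul_comm, Complex.exp_ofReal_mul_I_im]
  have hreal (b : ℝ) (hb : 0 ≤ b) (t : ℝ) (ht : 0 ≤ t) :
      (b : ℂ) + t * 1 ∈ slopeSector k := by
    simp only [slopeSector, mem_inter_iff, mem_ofPred_eq, mul_one, Complex.add_re, Complex.add_im,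
      Complex.ofReal_re, Complex.ofReal_im, add_zero, le_refl, true_and]
    constructor <;> positivity
  have hrot (t : ℝ) (ht : 0 ≤ t) : (tstar : ℂ) + t * e ∈ slopeSector k := by
    simp only [slopeSector, mem_inter_iff, mem_ofPred_eq, Complex.add_re, Complex.add_im,
      Complex.ofReal_re, Complex.ofReal_im, Complex.re_ofReal_mul, Complex.im_ofReal_mul, here,
      heim, zero_add]
    refine ⟨by positivity, by positivity, ?_⟩
    have : k * Real.cos θ = Real.sin θ := div_mul_cancel₀ _ hcos_pos.ne'
    nlinarith [mul_nonneg hk₀ ha]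
  obtain ⟨M, hM⟩ := exists_norm_exp_wPhaseC_le hx hy hz hk₀ hk
  have hdiff := differentiableOn_exp_wPhaseC hk₀ hk x y z
  refine ⟨fun t ht => one_add_sq_re_pos hk₀ hk (hrot t ht),
    integrableOn_ray hdiff.continuousOn hM (here ▸ hcos_pos) hrot, ?_⟩
  have hint : IntegrableOn (fun t : ℝ => Complex.exp (wPhase t x y z)) (Ioi 0) := by
    simpa [wPhaseC_ofReal] using
      integrableOn_ray hdiff.continuousOn hM (e := 1) (by simp) (hreal 0 le_rfl)
  rw [← intervalIntegral.integral_interval_add_Ioi hint (hint.mono_set (Ioi_subset_Ioi ha)),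
    setIntegral_Ioi_eq_comp_add]
  congr 1
  rw [← mul_integral_ray_eq (convex_slopeSector k) hdiff hM (e₁ := 1) (by simp)
    (here ▸ hcos_pos) (hreal tstar ha) hrot, one_mul]
  refine integral_congr_ae (.of_forall fun t => ?_)
  simp only [mul_one, ← Complex.ofReal_add, wPhaseC_ofReal]
end

section
/- Let x, z ∈ ℝ, y < 0, and ℓ = (ℓ₁, ℓ₂, ℓ₃) ∈ ℝ³. With ϖ∘(τ,ℓ) = ℓ₂(2τ²-2τ+1) + i(ℓ₁(1-τ) + ℓ₃τ)√(2τ²-2τ+1) and Φ_ℓ(τ) = (τ-1) e^{Λ(τ,x,y,z)} ∫_τ¹ ϖ∘(θ,ℓ) e^{-Λ(θ,x,y,z)}/(θ-1)⁴ dθ, the directional derivative integral satisfies ∫₀^∞ ϖ(t,ℓ₁,ℓ₂,ℓ₃) e^{ϖ(t,x,y,z)} dt = -e^{y+ix} · Φ_ℓ(0), both sides being absolutely convergent. -/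
open MeasureTheory Set

noncomputable def wPhaseCirc (τ l₁ l₂ l₃ : ℝ) : ℂ :=
  (l₂ * (2 * τ ^ 2 - 2 * τ + 1) : ℝ) +
    Complex.I * ((l₁ * (1 - τ) + l₃ * τ : ℝ) : ℂ) * ((Real.sqrt (2 * τ ^ 2 - 2 * τ + 1) : ℝ) : ℂ)

noncomputable def wPhiL (τ x y z l₁ l₂ l₃ : ℝ) : ℂ :=
  ((τ : ℂ) - 1) * Complex.exp (wLam τ x y z) *
    ∫ θ in τ..1, wPhaseCirc θ l₁ l₂ l₃ * Complex.exp (-(wLam θ x y z)) / ((θ : ℂ) - 1) ^ 4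

theorem hasDerivAt_div_one_sub {τ : ℝ} (hτ : τ < 1) :
    HasDerivAt (fun τ : ℝ => τ / (1 - τ)) (((1 - τ) ^ 2)⁻¹) τ := by
  have h : 1 - τ ≠ 0 := by linarith
  have e : (1 * (1 - τ) - τ * (-1)) / (1 - τ) ^ 2 = ((1 - τ) ^ 2)⁻¹ := by
    rw [inv_eq_one_div]
    ring_nf
  exact e ▸ (hasDerivAt_id' τ).fun_div ((hasDerivAt_id' τ).const_sub 1) h

theorem injOn_div_one_sub : InjOn (fun τ : ℝ => τ / (1 - τ)) (Ioo 0 1) := by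
  intro a ha b hb hab
  have h1 : 1 - a ≠ 0 := by linarith [ha.2]
  have h2 : 1 - b ≠ 0 := by linarith [hb.2]
  change a / (1 - a) = b / (1 - b) at hab
  rw [div_eq_div_iff h1 h2] at hab
  linarith

theorem image_div_one_sub : (fun τ : ℝ => τ / (1 - τ)) '' Ioo 0 1 = Ioi 0 := by
  ext t
  constructor
  · rintro ⟨a, ha, rfl⟩
    exact div_pos ha.1 (by linarith [ha.2])
  · intro ht
    have ht : 0 < t := ht
    have h1 : 1 + t ≠ 0 := by linarith
    refine ⟨t / (1 + t), ⟨by positivity, by rw [div_lt_one] <;> linarith⟩, ?_⟩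
    field_simp
    ring

theorem sqrt_one_add_div_one_sub_sq {τ : ℝ} (hτ : τ < 1) :
    Real.sqrt (1 + (τ / (1 - τ)) ^ 2) = Real.sqrt (2 * τ ^ 2 - 2 * τ + 1) / (1 - τ) := by
  have h : 0 < 1 - τ := by linarith
  have h' : 1 + (τ / (1 - τ)) ^ 2 = (2 * τ ^ 2 - 2 * τ + 1) / (1 - τ) ^ 2 := by
    field_simp
    ring
  rw [h', Real.sqrt_div' _ (by positivity), Real.sqrt_sq h.le]

theorem wPhase_div_one_sub {τ : ℝ} (hτ : τ < 1) (x y z : ℝ) :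
    wPhase (τ / (1 - τ)) x y z = wPhaseCirc τ x y z / ((τ : ℂ) - 1) ^ 2 := by
  have h : (τ : ℂ) - 1 ≠ 0 := by
    rw [sub_ne_zero]; exact_mod_cast hτ.ne
  have h' : 1 - (τ : ℂ) ≠ 0 := by rw [← neg_sub]; exact neg_ne_zero.mpr h
  have e : (τ : ℂ) - 1 = -(1 - τ) := by ring
  rw [wPhase, wPhaseCirc, sqrt_one_add_div_one_sub_sq hτ, e]
  push_cast
  field_simp
  ring

theorem wPhase_div_one_sub_eq_wLam {τ : ℝ} (hτ : τ < 1) (x y z : ℝ) :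
    wPhase (τ / (1 - τ)) x y z = 2 * y + -wLam τ x y z := by
  have h : (τ : ℂ) - 1 ≠ 0 := by
    rw [sub_ne_zero]; exact_mod_cast hτ.ne
  rw [wPhase_div_one_sub hτ, wPhaseCirc, wLam]
  push_cast
  field_simp
  ring

theorem continuous_wPhase (x y z : ℝ) : Continuous fun t : ℝ => wPhase t x y z := by
  unfold wPhase
  fun_prop

theorem norm_exp_wPhase (t x y z : ℝ) :
    ‖Complex.exp (wPhase t x y z)‖ = Real.exp (y * (1 + t ^ 2)) := by
  rw [Complex.norm_exp, wPhase, mul_assoc, ← Complex.ofReal_mul, Complex.add_re, Complex.ofReal_re,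
    Complex.I_mul_re, Complex.ofReal_im, neg_zero, add_zero]

theorem norm_wPhase_le (t x y z : ℝ) :
    ‖wPhase t x y z‖ ≤ (|x| + |y| + |z|) * (1 + t ^ 2) ^ 2 := by
  have h1 : ‖wPhase t x y z‖ ≤ |y| * (1 + t ^ 2) + |x + z * t| * Real.sqrt (1 + t ^ 2) := by
    refine (norm_add_le _ _).trans (le_of_eq ?_)
    rw [norm_mul, norm_mul, Complex.norm_I, one_mul, Complex.norm_real, Complex.norm_real,
      Complex.norm_real, Real.norm_eq_abs, Real.norm_eq_abs, Real.norm_eq_abs, abs_mul,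
      abs_of_nonneg (by positivity : 0 ≤ 1 + t ^ 2), abs_of_nonneg (Real.sqrt_nonneg _)]
  have hv : 1 ≤ 1 + t ^ 2 := by nlinarith
  have h2 : Real.sqrt (1 + t ^ 2) ≤ 1 + t ^ 2 := by
    rw [Real.sqrt_le_left (by positivity)]
    nlinarith
  have ht : |t| ≤ 1 + t ^ 2 := abs_le.mpr ⟨by nlinarith, by nlinarith⟩
  have h3 : |x + z * t| ≤ (|x| + |z|) * (1 + t ^ 2) := by
    calc |x + z * t| ≤ |x| + |z| * |t| := by rw [← abs_mul]; exact abs_add_le _ _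
      _ ≤ |x| * (1 + t ^ 2) + |z| * (1 + t ^ 2) := by
          gcongr
          exact le_mul_of_one_le_right (abs_nonneg x) hv
      _ = _ := by ring
  calc ‖wPhase t x y z‖ ≤ |y| * (1 + t ^ 2) + |x + z * t| * Real.sqrt (1 + t ^ 2) := h1
    _ ≤ |y| * (1 + t ^ 2) ^ 2 + (|x| + |z|) * (1 + t ^ 2) * (1 + t ^ 2) := by
        gcongr
        exact le_self_pow₀ hv two_ne_zero
    _ = _ := by ring

theorem sq_mul_exp_mul_le {v y : ℝ} (hv : 0 < v) (hy : y < 0) :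
    v ^ 2 * Real.exp (y * v) ≤ 6 / (-y) ^ 3 * v⁻¹ := by
  have hy' : 0 < -y := by linarith
  have h := Real.pow_div_factorial_le_exp (-y * v) (mul_pos hy' hv).le 3
  have e : Real.exp (y * v) = (Real.exp (-y * v))⁻¹ := by rw [← Real.exp_neg]; ring_nf
  have h6 : ((Nat.factorial 3 : ℕ) : ℝ) = 6 := by norm_num [Nat.factorial]
  rw [h6] at h
  calc v ^ 2 * Real.exp (y * v) ≤ v ^ 2 * ((-y * v) ^ 3 / 6)⁻¹ := by
        rw [e]
        have : 0 < (-y * v) ^ 3 / 6 := div_pos (pow_pos (mul_pos hy' hv) 3) (by norm_num)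
        gcongr
    _ = _ := by
        generalize -y = w at hy' ⊢
        field_simp

theorem integrable_wPhase_mul_exp (x y z l₁ l₂ l₃ : ℝ) (hy : y < 0) :
    Integrable fun t : ℝ => wPhase t l₁ l₂ l₃ * Complex.exp (wPhase t x y z) := by
  refine (integrable_inv_one_add_sq.const_mul
    ((|l₁| + |l₂| + |l₃|) * (6 / (-y) ^ 3))).mono' ?_ (ae_of_all _ fun t => ?_)
  · exact ((continuous_wPhase l₁ l₂ l₃).mul
      (Complex.continuous_exp.comp (continuous_wPhase x y z))).aestronglyMeasurable
  · rw [norm_mul, norm_exp_wPhase]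
    calc ‖wPhase t l₁ l₂ l₃‖ * Real.exp (y * (1 + t ^ 2))
        ≤ (|l₁| + |l₂| + |l₃|) * (1 + t ^ 2) ^ 2 * Real.exp (y * (1 + t ^ 2)) := by
          gcongr
          exact norm_wPhase_le t l₁ l₂ l₃
      _ = (|l₁| + |l₂| + |l₃|) * ((1 + t ^ 2) ^ 2 * Real.exp (y * (1 + t ^ 2))) := by ring
      _ ≤ (|l₁| + |l₂| + |l₃|) * (6 / (-y) ^ 3 * (1 + t ^ 2)⁻¹) :=
          mul_le_mul_of_nonneg_left (sq_mul_exp_mul_le (by positivity) hy) (by positivity)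
      _ = _ := by ring

theorem abs_deriv_smul_wPhase_mul_exp {τ : ℝ} (hτ : τ < 1) (x y z l₁ l₂ l₃ : ℝ) :
    |((1 - τ) ^ 2)⁻¹| • (wPhase (τ / (1 - τ)) l₁ l₂ l₃ *
        Complex.exp (wPhase (τ / (1 - τ)) x y z)) =
      Complex.exp (2 * y) *
        (wPhaseCirc τ l₁ l₂ l₃ * Complex.exp (-(wLam τ x y z)) / ((τ : ℂ) - 1) ^ 4) := by
  have h : (τ : ℂ) - 1 ≠ 0 := by
    rw [sub_ne_zero]; exact_mod_cast hτ.ne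
  have e : (1 - τ) ^ 2 = (τ - 1) ^ 2 := by ring
  rw [wPhase_div_one_sub_eq_wLam hτ x y z, Complex.exp_add, wPhase_div_one_sub hτ,
    abs_of_nonneg (inv_nonneg.mpr (sq_nonneg (1 - τ))), e, Complex.real_smul]
  push_cast
  field_simp

/-- The directional derivative of the wavelike integral expressed through the bounded
solution of the corresponding Levin ODE: for `y < 0`,
`∫₀^∞ ϖ(t,ℓ₁,ℓ₂,ℓ₃) e^{ϖ(t,x,y,z)} dt = -e^{y+ix} Φ_ℓ(0)`, both sides being absolutely
convergent. -/
theorem directional_derivative_via_wPhiL (x y z l₁ l₂ l₃ : ℝ) (hy : y < 0) :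
    IntegrableOn (fun t : ℝ => wPhase t l₁ l₂ l₃ * Complex.exp (wPhase t x y z))
      (Set.Ioi 0) ∧
    IntegrableOn
      (fun θ : ℝ => wPhaseCirc θ l₁ l₂ l₃ * Complex.exp (-(wLam θ x y z)) / ((θ : ℂ) - 1) ^ 4)
      (Set.Ioo 0 1) ∧
    ∫ t in Set.Ioi (0 : ℝ), wPhase t l₁ l₂ l₃ * Complex.exp (wPhase t x y z) =
      -Complex.exp ((y : ℂ) + Complex.I * (x : ℂ)) * wPhiL 0 x y z l₁ l₂ l₃ := by
  have hint := (integrable_wPhase_mul_exp x y z l₁ l₂ l₃ hy).integrableOn (s := Ioi 0)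
  have hd : ∀ τ ∈ Ioo (0 : ℝ) 1, HasDerivWithinAt (fun τ : ℝ => τ / (1 - τ))
      (((1 - τ) ^ 2)⁻¹) (Ioo 0 1) τ :=
    fun τ hτ => (hasDerivAt_div_one_sub hτ.2).hasDerivWithinAt
  have heq : EqOn (fun τ : ℝ => |((1 - τ) ^ 2)⁻¹| • (wPhase (τ / (1 - τ)) l₁ l₂ l₃ *
        Complex.exp (wPhase (τ / (1 - τ)) x y z)))
      (fun τ : ℝ => Complex.exp (2 * y) *
        (wPhaseCirc τ l₁ l₂ l₃ * Complex.exp (-(wLam τ x y z)) / ((τ : ℂ) - 1) ^ 4))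
      (Ioo 0 1) :=
    fun τ hτ => abs_deriv_smul_wPhase_mul_exp hτ.2 x y z l₁ l₂ l₃
  refine ⟨hint, ?_, ?_⟩
  · rw [← image_div_one_sub, integrableOn_image_iff_integrableOn_abs_deriv_smul
      measurableSet_Ioo hd injOn_div_one_sub, integrableOn_congr_fun heq measurableSet_Ioo] at hint
    exact (integrable_const_mul_iff (Complex.exp_ne_zero _).isUnit _).mp hint
  · rw [← image_div_one_sub, integral_image_eq_integral_abs_deriv_smul
      measurableSet_Ioo hd injOn_div_one_sub, setIntegral_congr_fun measurableSet_Ioo heq,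
      integral_const_mul, wPhiL, intervalIntegral.integral_of_le zero_le_one,
      integral_Ioc_eq_integral_Ioo]
    have h0 : wLam 0 x y z = y - Complex.I * x := by
      simp [wLam]
      ring
    have h2 : Complex.exp (2 * y) =
        Complex.exp (y + Complex.I * x) * Complex.exp (y - Complex.I * x) := by
      rw [← Complex.exp_add]
      ring_nf
    rw [h0, h2]
    push_cast
    ring
end
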